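/- arXiv:1409.1764 — 4 statements merged into one kernel-verified Lean document; each statement's English description precedes it below -/
import Mathlib

section
/- The operation * on ℂ² satisfies the three quandle axioms: (i) a * a = a for every a ∈ ℂ²; (ii) for every b ∈ ℂ², the map a ↦ a * b is a bijection of ℂ² onto itself (and it maps ℂ² \ {0} bijectively onto ℂ² \ {0}); (iii) (a * b) * c = (a * c) * (b * c) for all a, b, c ∈ ℂ². -/
/-- The quandle operation `a * b := M(b)·a` on `ℂ²`, written out explicitly as the
matrix-vector product with `M(b) = !![1 + b₁b₂, -b₁²; b₂², 1 - b₁b₂]`. -/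
noncomputable def qop (a b : ℂ × ℂ) : ℂ × ℂ :=
  ((1 + b.1 * b.2) * a.1 - b.1 ^ 2 * a.2, b.2 ^ 2 * a.1 + (1 - b.1 * b.2) * a.2)

/-- `*` satisfies the three quandle axioms; moreover each right
translation maps `ℂ² \ {0}` bijectively onto `ℂ² \ {0}`. -/
theorem qop_quandle_axioms :
    (∀ a : ℂ × ℂ, qop a a = a) ∧
    (∀ b : ℂ × ℂ, Function.Bijective (fun a => qop a b) ∧
      Set.BijOn (fun a => qop a b) {a : ℂ × ℂ | a ≠ 0} {a : ℂ × ℂ | a ≠ 0}) ∧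
    (∀ a b c : ℂ × ℂ, qop (qop a b) c = qop (qop a c) (qop b c)) := by
  have h0 : ∀ b : ℂ × ℂ, qop 0 b = 0 := by
    intro b
    ext <;> simp [qop]
  have hb : ∀ b : ℂ × ℂ, Function.Bijective (fun a => qop a b) := by
    intro b
    refine Function.bijective_iff_has_inverse.mpr
      ⟨fun a => ((1 - b.1 * b.2) * a.1 + b.1 ^ 2 * a.2,
        - b.2 ^ 2 * a.1 + (1 + b.1 * b.2) * a.2), ?_, ?_⟩
    · intro a
      ext <;> simp only [qop] <;> ring
    · intro a
      ext <;> simp only [qop] <;> ring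
  refine ⟨?_, ?_, ?_⟩
  · intro a
    ext <;> simp only [qop] <;> ring
  · intro b
    refine ⟨hb b, ?_, (hb b).1.injOn, ?_⟩
    · intro a ha h
      exact ha ((hb b).1 (h.trans (h0 b).symm))
    · intro y hy
      obtain ⟨x, hx⟩ := (hb b).2 y
      refine ⟨x, ?_, hx⟩
      rintro rfl
      exact hy (hx.symm.trans (h0 b))
  · intro a b c
    ext <;> simp only [qop] <;> ring
end

section
/- For all a, b ∈ ℂ², M(a * b) = M(b) · M(a) · M(b)⁻¹. In other words, under the correspondence v ↦ M(v), the operation * on ℂ² corresponds to the conjugation quandle operation x * y = y x y⁻¹ on matrices. -/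
/-- The matrix `M(v)` associated to `v = (v₁, v₂) ∈ ℂ²`. -/
noncomputable def qmat (v : ℂ × ℂ) : Matrix (Fin 2) (Fin 2) ℂ :=
  !![1 + v.1 * v.2, -v.1 ^ 2; v.2 ^ 2, 1 - v.1 * v.2]

/-- under `v ↦ M(v)`, the operation `*` corresponds to conjugation:
`M(a * b) = M(b) · M(a) · M(b)⁻¹`. -/
theorem qmat_qop_conj (a b : ℂ × ℂ) :
    qmat (qop a b) = qmat b * qmat a * (qmat b)⁻¹ := by
  have hdet : (qmat b).det = 1 := by
    simp only [qmat, Matrix.det_fin_two_of]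
    ring
  have hu : IsUnit (qmat b).det := by rw [hdet]; exact isUnit_one
  have key : qmat (qop a b) * qmat b = qmat b * qmat a := by
    ext i j
    fin_cases i <;> fin_cases j <;>
      simp [qmat, qop, Matrix.mul_apply, Fin.sum_univ_two] <;> ring
  rw [← key, Matrix.mul_nonsing_inv_cancel_right _ _ hu]
end

section
/- Let a_k, a_l ∈ ℂ² \ {0} satisfy det(a_k, a_l) = 0 (a degenerate crossing), and let s, p ∈ ℂ² be such that det(a_k, s) ≠ 0, det(a_l, s) ≠ 0, det(a_l * a_k, s * a_k) ≠ 0, and det(a_k, s * a_l) ≠ 0. Then the four side values around the crossing coincide: det(a_k, p)/det(a_k, s) = det(a_l * a_k, p)/det(a_l * a_k, s * a_k) = det(a_k, p)/det(a_k, s * a_l) = det(a_l, p)/det(a_l, s). -/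
/-- `det(a, b) := a₁b₂ − b₁a₂`. -/
noncomputable def det2 (a b : ℂ × ℂ) : ℂ := a.1 * b.2 - b.1 * a.2

/-- at a degenerate crossing (`det(a_k, a_l) = 0`, both arc-colors
nonzero), the four side values `z^{(0)} = det(arc, p)/det(arc, region)` around the
crossing coincide. -/
theorem degenerate_crossing_side_values (ak al s p : ℂ × ℂ)
    (hk : ak ≠ 0) (hl : al ≠ 0) (hdeg : det2 ak al = 0)
    (h1 : det2 ak s ≠ 0) (h2 : det2 al s ≠ 0)
    (h3 : det2 (qop al ak) (qop s ak) ≠ 0) (h4 : det2 ak (qop s al) ≠ 0) :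
    det2 ak p / det2 ak s = det2 (qop al ak) p / det2 (qop al ak) (qop s ak) ∧
    det2 ak p / det2 ak s = det2 ak p / det2 ak (qop s al) ∧
    det2 ak p / det2 ak s = det2 al p / det2 al s := by
  have e1 : qop al ak = al := by
    unfold det2 at hdeg
    apply Prod.ext
    · simp only [qop]; linear_combination (-ak.1) * hdeg
    · simp only [qop]; linear_combination (-ak.2) * hdeg
  have e2 : det2 al (qop s ak) = det2 al s := by
    simp only [det2, qop] at hdeg ⊢
    linear_combination (ak.1 * s.2 - s.1 * ak.2) * hdeg
  have e3 : det2 ak (qop s al) = det2 ak s := by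
    simp only [det2, qop] at hdeg ⊢
    linear_combination (-(al.1 * s.2 - s.1 * al.2)) * hdeg
  have e4 : det2 ak p / det2 ak s = det2 al p / det2 al s := by
    rw [div_eq_div_iff h1 h2]
    simp only [det2] at hdeg ⊢
    linear_combination (p.1 * s.2 - s.1 * p.2) * hdeg
  rw [e1, e2, e3]
  exact ⟨e4, rfl, e4⟩
end

section
/- Let a_k, a_l, s, p ∈ ℂ² be such that the vectors s * a_k, p, a_l * a_k, a_k all have nonzero second coordinates и suppose det(s * a_k, a_l * a_k) ≠ 0, det(a_k, p) ≠ 0, det(a_k, s) ≠ 0, and det(a_l * a_k, s * a_k) ≠ 0. Then the cross-ratio [h(s * a_k), h(p), h(a_l * a_k), h(a_k)] equals z_f/z_e, where z_e := det(a_k, p)/det(a_k, s) and z_f := det(a_l * a_k, p)/det(a_l * a_k, s * a_k). -/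
/-- The Hopf map `h(v) := v₁ / v₂` (for `v₂ ≠ 0`). -/
noncomputable def hopf (v : ℂ × ℂ) : ℂ := v.1 / v.2

/-- The cross-ratio `[v₀, v₁, v₂, v₃]`. -/
noncomputable def crossRatio (v0 v1 v2 v3 : ℂ) : ℂ :=
  ((v3 - v0) / (v2 - v0)) * ((v2 - v1) / (v3 - v1))

theorem hopf_sub_aux (a b : ℂ × ℂ) (ha : a.2 ≠ 0) (hb : b.2 ≠ 0) :
    hopf a - hopf b = det2 a b / (a.2 * b.2) := by
  unfold hopf det2
  field_simp

theorem det2_qop_aux (a s : ℂ × ℂ) : det2 a (qop s a) = det2 a s := by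
  unfold det2 qop
  ring

/-- the shape parameter of the horizontal edge `A_jB_j`:
`[h(s * a_k), h(p), h(a_l * a_k), h(a_k)] = z_f / z_e` with
`z_e = det(a_k, p)/det(a_k, s)` and `z_f = det(a_l * a_k, p)/det(a_l * a_k, s * a_k)`. -/
theorem crossRatio_eq_zf_div_ze (ak al s p : ℂ × ℂ)
    (h0 : (qop s ak).2 ≠ 0) (h1 : p.2 ≠ 0) (h2 : (qop al ak).2 ≠ 0) (h3 : ak.2 ≠ 0)
    (d0 : det2 (qop s ak) (qop al ak) ≠ 0) (d1 : det2 ak p ≠ 0)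
    (d2 : det2 ak s ≠ 0) (d3 : det2 (qop al ak) (qop s ak) ≠ 0) :
    crossRatio (hopf (qop s ak)) (hopf p) (hopf (qop al ak)) (hopf ak) =
      (det2 (qop al ak) p / det2 (qop al ak) (qop s ak)) / (det2 ak p / det2 ak s) := by
  rw [crossRatio, hopf_sub_aux _ _ h3 h0, hopf_sub_aux _ _ h2 h0, hopf_sub_aux _ _ h2 h1,
    hopf_sub_aux _ _ h3 h1, det2_qop_aux]
  generalize det2 (qop al ak) (qop s ak) = D at *
  generalize det2 (qop al ak) p = E at *
  generalize det2 ak p = F at *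
  generalize det2 ak s = G at *
  generalize (qop s ak).2 = x at *
  generalize (qop al ak).2 = y at *
  field_simp
end
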